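/- arXiv:2209.00683 — 2 statements merged into one kernel-verified Lean document; each statement's English description precedes it below -/
import Mathlib

section
/- The continuous linear map ρ·id_U + T* ∘ T : U → U is bijective with continuous inverse, and the unique minimizer u₀ of J over U is given by u₀ = (ρ·id_U + T* ∘ T)⁻¹ (T* θ), where T* : H → U denotes the Hilbert-space adjoint of T. -/
open ContinuousLinearMap

/-- The continuous linear map `ρ • id + T* ∘ T : U → U` is bijective with continuous
inverse (i.e. it is a continuous linear equivalence), and the unique minimizer of
`J u = ‖T u - θ‖² + ρ‖u‖²` over `U` is `u₀ = (ρ • id + T* ∘ T)⁻¹ (T* θ)`. -/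
theorem minimizer_eq_inverse_apply
    {U H : Type*} [NormedAddCommGroup U] [InnerProductSpace ℝ U] [CompleteSpace U]
    [NormedAddCommGroup H] [InnerProductSpace ℝ H] [CompleteSpace H]
    (T : U →L[ℝ] H) (ρ : ℝ) (hρ : 0 < ρ) (θ : H) :
    ∃ e : U ≃L[ℝ] U,
      (e : U →L[ℝ] U) = ρ • ContinuousLinearMap.id ℝ U + (adjoint T).comp T ∧
      ∀ u₀ : U,
        (∀ u : U, ‖T u₀ - θ‖ ^ 2 + ρ * ‖u₀‖ ^ 2 ≤ ‖T u - θ‖ ^ 2 + ρ * ‖u‖ ^ 2) ↔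
          u₀ = e.symm (adjoint T θ) := by
  set A : U →L[ℝ] U := ρ • ContinuousLinearMap.id ℝ U + (adjoint T).comp T with hA
  have hAi : ∀ u v : U, inner ℝ (A u) v = ρ * inner ℝ u v + inner ℝ (T u) (T v) := by
    intro u v
    simp [hA, inner_add_left, inner_smul_left, adjoint_inner_left]
  have hc : IsCoercive ((innerSL ℝ).comp A : U →L[ℝ] U →L[ℝ] ℝ) := by
    refine ⟨ρ, hρ, fun u => ?_⟩
    have h : ((innerSL ℝ).comp A : U →L[ℝ] U →L[ℝ] ℝ) u u = inner ℝ (A u) u := rfl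
    rw [h, hAi, real_inner_self_eq_norm_sq, real_inner_self_eq_norm_sq]
    nlinarith [sq_nonneg ‖T u‖]
  have he : ∀ u, hc.continuousLinearEquivOfBilin u = A u := by
    intro u
    refine ext_inner_right ℝ fun v => ?_
    rw [hc.continuousLinearEquivOfBilin_apply]
    rfl
  refine ⟨hc.continuousLinearEquivOfBilin, ContinuousLinearMap.ext he, ?_⟩
  obtain ⟨w, hw⟩ : ∃ w, w = hc.continuousLinearEquivOfBilin.symm (adjoint T θ) := ⟨_, rfl⟩
  have hAw : A w = adjoint T θ := by
    rw [← he, hw, ContinuousLinearEquiv.apply_symm_apply]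
  have key : ∀ u : U, ‖T u - θ‖ ^ 2 + ρ * ‖u‖ ^ 2 =
      ‖T w - θ‖ ^ 2 + ρ * ‖w‖ ^ 2 + (‖T (u - w)‖ ^ 2 + ρ * ‖u - w‖ ^ 2) := by
    intro u
    obtain ⟨d, rfl⟩ : ∃ d, u = w + d := ⟨u - w, by abel⟩
    have h1 := hAi w d
    rw [hAw, adjoint_inner_left] at h1
    have h2 : T (w + d) - θ = (T w - θ) + T d := by rw [map_add]; abel
    rw [h2, norm_add_sq_real, norm_add_sq_real, inner_sub_left, add_sub_cancel_left]
    linarith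
  intro u₀
  rw [← hw]
  constructor
  · intro h
    have h1 := h w
    rw [key u₀] at h1
    have h2 : ρ * ‖u₀ - w‖ ^ 2 ≤ 0 := by nlinarith [sq_nonneg ‖T (u₀ - w)‖]
    have h3 : ‖u₀ - w‖ ^ 2 = 0 := le_antisymm (by nlinarith) (sq_nonneg _)
    exact sub_eq_zero.mp (norm_eq_zero.mp (pow_eq_zero_iff two_ne_zero |>.mp h3))
  · rintro rfl u
    rw [key u]
    have : 0 ≤ ‖T (u - u₀)‖ ^ 2 + ρ * ‖u - u₀‖ ^ 2 := by positivity
    linarith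
end

section
/- For every K ∈ ℕ and every u ∈ L²(0,t_F), the tail sum satisfies ∑_{k=K+1}^∞ c_k(u)² ≤ ( ∑_{k=K+1}^∞ β_k² ) · ‖u‖²_{L²(0,t_F)} / ( k_α · ((K+1)π/L)² ), where c_k(u) = ∫₀^{t_F} exp( −k_α (kπ/L)² (t_F − τ) ) · β_k · u(τ) dτ. -/
open MeasureTheory

lemma exp_sq_integral (a T : ℝ) (ha : 0 < a) (hT : 0 < T) :
    ∫ τ, Real.exp (-a * (T - τ)) * Real.exp (-a * (T - τ))
      ∂(volume.restrict (Set.Ioo (0 : ℝ) T)) ≤ 1 / a := by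
  rw [← integral_Ioc_eq_integral_Ioo, ← intervalIntegral.integral_of_le hT.le]
  have h : ∀ τ ∈ Set.uIcc 0 T, HasDerivAt
      (fun τ => Real.exp (-a * (T - τ)) * Real.exp (-a * (T - τ)) / (2 * a))
      (Real.exp (-a * (T - τ)) * Real.exp (-a * (T - τ))) τ := by
    intro τ _
    have h1 : HasDerivAt (fun τ : ℝ => -a * (T - τ)) (-a * (-1)) τ :=
      ((hasDerivAt_id τ).const_sub T).const_mul (-a)
    have h2 := ((h1.exp.mul h1.exp).div_const (2 * a))
    refine h2.congr_deriv ?_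
    field_simp
    ring
  rw [intervalIntegral.integral_eq_sub_of_hasDerivAt h
    (Continuous.intervalIntegrable (by fun_prop) _ _)]
  have h3 : 0 ≤ Real.exp (-a * (T - 0)) * Real.exp (-a * (T - 0)) / (2 * a) := by positivity
  have h4 : Real.exp (-a * (T - T)) * Real.exp (-a * (T - T)) / (2 * a) ≤ 1 / a := by
    simp only [sub_self, mul_zero, Real.exp_zero, mul_one]
    apply one_div_le_one_div_of_le ha
    linarith
  linarith

lemma modal_sq (a T : ℝ) (ha : 0 < a) (hT : 0 < T)
    (u : Lp (E := ℝ) 2 (volume.restrict (Set.Ioo (0 : ℝ) T))) :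
    (∫ τ, Real.exp (-a * (T - τ)) * u τ ∂(volume.restrict (Set.Ioo (0 : ℝ) T))) ^ 2
      ≤ ‖u‖ ^ 2 / a := by
  have hg : MemLp (fun τ => Real.exp (-a * (T - τ))) 2
      (volume.restrict (Set.Ioo (0 : ℝ) T)) := by
    refine MemLp.of_bound (Continuous.aestronglyMeasurable (by fun_prop)) 1 ?_
    filter_upwards [ae_restrict_mem measurableSet_Ioo] with τ hτ
    rw [Real.norm_eq_abs, Real.abs_exp, Real.exp_le_one_iff]
    nlinarith [hτ.2]
  have e1 : inner ℝ (hg.toLp _) u =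
      ∫ τ, Real.exp (-a * (T - τ)) * u τ ∂(volume.restrict (Set.Ioo (0 : ℝ) T)) := by
    rw [L2.inner_def]
    refine integral_congr_ae ?_
    filter_upwards [hg.coeFn_toLp] with τ h
    rw [h]
    simp [mul_comm]
  have e2 : ‖hg.toLp _‖ ^ 2 = ∫ τ, Real.exp (-a * (T - τ)) * Real.exp (-a * (T - τ))
      ∂(volume.restrict (Set.Ioo (0 : ℝ) T)) := by
    rw [← real_inner_self_eq_norm_sq, L2.inner_def]
    refine integral_congr_ae ?_
    filter_upwards [hg.coeFn_toLp] with τ h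
    rw [h]
    simp [sq]
  have h3 := exp_sq_integral a T ha hT
  rw [← e2] at h3
  rw [← e1, ← sq_abs]
  calc _ ≤ (‖hg.toLp _‖ * ‖u‖) ^ 2 :=
        pow_le_pow_left₀ (abs_nonneg _) (abs_real_inner_le_norm _ _) 2
    _ = ‖hg.toLp _‖ ^ 2 * ‖u‖ ^ 2 := by ring
    _ ≤ 1 / a * ‖u‖ ^ 2 := by gcongr
    _ = _ := by ring

/-- Tail bound for the modal coefficients
`c_k(u) = ∫₀^{t_F} exp(−k_α (kπ/L)² (t_F − τ)) β_k u(τ) dτ`: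
for every `K` and every `u ∈ L²(0,t_F)`,
`∑_{k=K+1}^∞ c_k(u)² ≤ (∑_{k=K+1}^∞ β_k²) ‖u‖² / (k_α ((K+1)π/L)²)`. -/
theorem modal_tail_bound
    (kα L t_F : ℝ) (hkα : 0 < kα) (hL : 0 < L) (ht : 0 < t_F)
    (β : ℕ → ℝ) (hβ : Summable fun k : ℕ => β k ^ 2)
    (u : Lp (E := ℝ) 2 (volume.restrict (Set.Ioo (0 : ℝ) t_F)))
    (c : ℕ → ℝ)
    (hc : ∀ k : ℕ, c k =
      ∫ τ, Real.exp (-(kα * ((k : ℝ) * Real.pi / L) ^ 2) * (t_F - τ)) * β k * u τ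
        ∂(volume.restrict (Set.Ioo (0 : ℝ) t_F))) :
    ∀ K : ℕ,
      (∑' j : ℕ, c (j + (K + 1)) ^ 2) ≤
        (∑' j : ℕ, β (j + (K + 1)) ^ 2) * ‖u‖ ^ 2 /
          (kα * (((K : ℝ) + 1) * Real.pi / L) ^ 2) := by
  intro K
  have hpi := Real.pi_pos
  have hb : ∀ j : ℕ, c (j + (K + 1)) ^ 2 ≤ β (j + (K + 1)) ^ 2 *
      (‖u‖ ^ 2 / (kα * (((K : ℝ) + 1) * Real.pi / L) ^ 2)) := by
    intro j
    set k := j + (K + 1) with hk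
    have hkK : (K : ℝ) + 1 ≤ (k : ℝ) := by
      rw [hk]; push_cast
      linarith [(Nat.cast_nonneg j : (0 : ℝ) ≤ j)]
    have hk0 : (0 : ℝ) < k := lt_of_lt_of_le (by positivity) hkK
    have h := modal_sq (kα * ((k : ℝ) * Real.pi / L) ^ 2) t_F (by positivity) ht u
    have e : c k = β k * ∫ τ, Real.exp (-(kα * ((k : ℝ) * Real.pi / L) ^ 2) * (t_F - τ)) * u τ
        ∂(volume.restrict (Set.Ioo (0 : ℝ) t_F)) := by
      rw [hc k, ← integral_const_mul]
      congr 1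
      ext τ
      ring
    rw [e, mul_pow]
    refine mul_le_mul_of_nonneg_left (h.trans ?_) (sq_nonneg _)
    gcongr
  have hs : Summable fun j : ℕ => β (j + (K + 1)) ^ 2 :=
    (summable_nat_add_iff (f := fun k : ℕ => β k ^ 2) (K + 1)).2 hβ
  have hs2 := hs.mul_right (‖u‖ ^ 2 / (kα * (((K : ℝ) + 1) * Real.pi / L) ^ 2))
  rw [mul_div_assoc, ← tsum_mul_right]
  exact (Summable.of_nonneg_of_le (fun _ => sq_nonneg _) hb hs2).tsum_le_tsum hb hs2
end
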